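/- Let M, N ⊆ B(H_μ), B(H_ν) be ℤ₂-graded von Neumann algebras with cyclic vectors ξ_μ, ξ_ν fixed by the grading unitaries Γ_μ, Γ_ν, and Ψ : M → N a positive linear map with ν ∘ Ψ = μ where μ, ν are the corresponding vector states. Define the twisted dual Ψ^⁇ := κ_μ ∘ Ψ′ ∘ κ_ν restricted to N^⁇, where Ψ′ : N′ → M′ is the usual dual map determined by ⟨Ψ′(b′) a ξ_μ, ξ_μ⟩ = ⟨b′ Ψ(a) ξ_ν, ξ_ν⟩. Then Ψ^⁇ maps N^⁇ into M^⁇ and satisfies ⟨Ψ^⁇(b) a ξ_μ, ξ_μ⟩ = ⟨b Ψ(a) ξ_ν, ξ_ν⟩ for all a ∈ M and b ∈ N^⁇, and it is the unique map with this property. -/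

import Mathlib

noncomputable def evenPart {H : Type*} [NormedAddCommGroup H] [InnerProductSpace ℂ H]
    [CompleteSpace H] (Γ a : H →L[ℂ] H) : H →L[ℂ] H :=
  (2 : ℂ)⁻¹ • (a + Γ * a * Γ)

noncomputable def oddPart {H : Type*} [NormedAddCommGroup H] [InnerProductSpace ℂ H]
    [CompleteSpace H] (Γ a : H →L[ℂ] H) : H →L[ℂ] H :=
  (2 : ℂ)⁻¹ • (a - Γ * a * Γ)

/-- The Klein transformation `κ_Γ(a) = a₊ + Γ a₋`. -/
noncomputable def klein {H : Type*} [NormedAddCommGroup H] [InnerProductSpace ℂ H]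
    [CompleteSpace H] (Γ a : H →L[ℂ] H) : H →L[ℂ] H :=
  evenPart Γ a + Γ * oddPart Γ a

/-- The Klein transformation is an involution when `Γ² = 1`. -/
theorem klein_klein {H : Type*} [NormedAddCommGroup H] [InnerProductSpace ℂ H]
    [CompleteSpace H] {Γ : H →L[ℂ] H} (hΓ : Γ * Γ = 1) (a : H →L[ℂ] H) :
    klein Γ (klein Γ a) = a := by
  have hΓx : ∀ x, Γ (Γ x) = x := fun x => by
    simpa using congrArg (fun T : H →L[ℂ] H => T x) hΓ
  ext x
  simp only [klein, evenPart, oddPart, add_apply,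
    sub_apply, smul_apply,
    mul_apply_eq_comp, map_add, map_sub, map_smul, hΓx]
  module

/-- The Klein transformation does not change matrix coefficients against a `Γ`-fixed vector. -/
theorem inner_klein_apply {H : Type*} [NormedAddCommGroup H] [InnerProductSpace ℂ H]
    [CompleteSpace H] {Γ : H →L[ℂ] H} (hsa : star Γ = Γ) {ξ : H}
    (hξ : Γ ξ = ξ) (a : H →L[ℂ] H) (x : H) :
    inner ℂ (klein Γ a x) ξ = inner ℂ (a x) ξ := by
  have hΓ : ∀ y, inner ℂ (Γ y) ξ = inner ℂ y ξ := fun y => by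
    have h := ContinuousLinearMap.adjoint_inner_left Γ ξ y
    rwa [← ContinuousLinearMap.star_eq_adjoint, hsa, hξ] at h
  have hx : klein Γ a x = evenPart Γ a x + Γ (oddPart Γ a x) := rfl
  have ha : evenPart Γ a x + oddPart Γ a x = a x := by
    simp only [evenPart, oddPart, add_apply,
      sub_apply, smul_apply]
    module
  rw [hx, inner_add_left, hΓ, ← inner_add_left, ha]

/-- An element of the commutant of `M` is determined by its matrix coefficients
`⟨c a ξ, ξ⟩`, `a ∈ M`, for a cyclic vector `ξ`. -/
theorem eq_of_mem_commutant_of_inner_eq {H : Type*} [NormedAddCommGroup H]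
    [InnerProductSpace ℂ H] [CompleteSpace H] (M : VonNeumannAlgebra H) {ξ : H}
    (hcyc : Dense {x : H | ∃ a ∈ (M : Set (H →L[ℂ] H)), x = a ξ})
    {c d : H →L[ℂ] H} (hc : c ∈ M.commutant) (hd : d ∈ M.commutant)
    (h : ∀ a ∈ M, inner ℂ (c (a ξ)) ξ = inner ℂ (d (a ξ)) ξ) : c = d := by
  have hstar : star c ξ = star d ξ := by
    refine hcyc.eq_of_inner_right ℂ ?_
    rintro _ ⟨a, ha, rfl⟩
    simpa only [ContinuousLinearMap.star_eq_adjoint,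
      ContinuousLinearMap.adjoint_inner_right] using h a ha
  refine star_injective (ContinuousLinearMap.ext fun x => ?_)
  refine congrFun (Continuous.ext_on hcyc (star c).continuous (star d).continuous ?_) x
  rintro _ ⟨a, ha, rfl⟩
  have hcomm : ∀ e ∈ M.commutant, star e (a ξ) = a (star e ξ) := fun e he =>
    (congrArg (fun T : H →L[ℂ] H => T ξ)
      (VonNeumannAlgebra.mem_commutant_iff.1 (star_mem he) a ha)).symm
  rw [hcomm c hc, hcomm d hd, hstar]

/-- Existence and uniqueness of the twisted dual `Ψ^⁇ = κ_μ ∘ Ψ′ ∘ κ_ν` of a positive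
state-preserving linear map `Ψ : M → N` between graded von Neumann algebras: it maps
`N^⁇` into `M^⁇`, satisfies `⟨Ψ^⁇(b) a ξ_μ, ξ_μ⟩ = ⟨b Ψ(a) ξ_ν, ξ_ν⟩` for all
`a ∈ M`, `b ∈ N^⁇`, and is the unique such map. -/
theorem twistedDual_exists_unique
    {Hμ Hν : Type*}
    [NormedAddCommGroup Hμ] [InnerProductSpace ℂ Hμ] [CompleteSpace Hμ]
    [NormedAddCommGroup Hν] [InnerProductSpace ℂ Hν] [CompleteSpace Hν]
    (M : VonNeumannAlgebra Hμ) (N : VonNeumannAlgebra Hν)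
    (Γμ : Hμ →L[ℂ] Hμ) (Γν : Hν →L[ℂ] Hν)
    (hμsa : star Γμ = Γμ) (hμunit : Γμ * Γμ = 1)
    (hνsa : star Γν = Γν) (hνunit : Γν * Γν = 1)
    (hMstab : ∀ a ∈ M, Γμ * a * Γμ ∈ M) (hNstab : ∀ b ∈ N, Γν * b * Γν ∈ N)
    (ξμ : Hμ) (ξν : Hν) (hξμfix : Γμ ξμ = ξμ) (hξνfix : Γν ξν = ξν)
    (hcyc : Dense {x : Hμ | ∃ a ∈ (M : Set (Hμ →L[ℂ] Hμ)), x = a ξμ})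
    (Ψ : (Hμ →L[ℂ] Hμ) →ₗ[ℂ] (Hν →L[ℂ] Hν))
    (hΨmem : ∀ a ∈ M, Ψ a ∈ N)
    (hΨpos : ∀ a : Hμ →L[ℂ] Hμ, a.IsPositive → (Ψ a).IsPositive)
    (hΨstate : ∀ a ∈ M, @inner ℂ Hν _ ((Ψ a) ξν) ξν = @inner ℂ Hμ _ (a ξμ) ξμ)
    (Ψ' : (Hν →L[ℂ] Hν) →ₗ[ℂ] (Hμ →L[ℂ] Hμ))
    (hΨ'mem : ∀ b ∈ N.commutant, Ψ' b ∈ M.commutant)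
    (hΨ'dual : ∀ a ∈ M, ∀ b ∈ N.commutant,
      @inner ℂ Hμ _ ((Ψ' b) (a ξμ)) ξμ = @inner ℂ Hν _ (b ((Ψ a) ξν)) ξν) :
    (∀ b ∈ klein Γν '' (N.commutant : Set (Hν →L[ℂ] Hν)),
      klein Γμ (Ψ' (klein Γν b)) ∈ klein Γμ '' (M.commutant : Set (Hμ →L[ℂ] Hμ))) ∧
    (∀ a ∈ M, ∀ b ∈ klein Γν '' (N.commutant : Set (Hν →L[ℂ] Hν)),
      @inner ℂ Hμ _ ((klein Γμ (Ψ' (klein Γν b))) (a ξμ)) ξμ =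
        @inner ℂ Hν _ (b ((Ψ a) ξν)) ξν) ∧
    (∀ Φ : (Hν →L[ℂ] Hν) → (Hμ →L[ℂ] Hμ),
      (∀ b ∈ klein Γν '' (N.commutant : Set (Hν →L[ℂ] Hν)),
        Φ b ∈ klein Γμ '' (M.commutant : Set (Hμ →L[ℂ] Hμ))) →
      (∀ a ∈ M, ∀ b ∈ klein Γν '' (N.commutant : Set (Hν →L[ℂ] Hν)),
        @inner ℂ Hμ _ ((Φ b) (a ξμ)) ξμ = @inner ℂ Hν _ (b ((Ψ a) ξν)) ξν) →
      ∀ b ∈ klein Γν '' (N.commutant : Set (Hν →L[ℂ] Hν)),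
        Φ b = klein Γμ (Ψ' (klein Γν b))) := by
  refine ⟨?_, ?_, ?_⟩
  · rintro _ ⟨b, hb, rfl⟩
    rw [klein_klein hνunit]
    exact ⟨Ψ' b, hΨ'mem b hb, rfl⟩
  · rintro a ha _ ⟨b, hb, rfl⟩
    rw [klein_klein hνunit, inner_klein_apply hμsa hξμfix, inner_klein_apply hνsa hξνfix]
    exact hΨ'dual a ha b hb
  · rintro Φ hΦmem hΦdual _ ⟨b, hb, rfl⟩
    obtain ⟨c, hc, hΦc⟩ := hΦmem _ ⟨b, hb, rfl⟩
    rw [klein_klein hνunit, ← hΦc]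
    refine congrArg (klein Γμ)
      (eq_of_mem_commutant_of_inner_eq M hcyc hc (hΨ'mem b hb) fun a ha => ?_)
    rw [hΨ'dual a ha b hb, ← inner_klein_apply hμsa hξμfix, hΦc, hΦdual a ha _ ⟨b, hb, rfl⟩,
      inner_klein_apply hνsa hξνfix]
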